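/- arXiv:2207.04629 — 7 statements merged into one kernel-verified Lean document; each statement's English description precedes it below -/
import Mathlib

section
/- Let q = p^e with p an odd prime and e a positive integer. Then: (i) S = S⁻¹, i.e., the set S is closed under taking inverses in G; and (ii) two distinct points p, r ∈ F_q^5 are adjacent in Γ^(2)(q) if and only if p = r·s for some s ∈ S. Consequently Γ^(2)(q) is the (undirected) Cayley graph Cay(G, S). -/
/-- Quintuples over `F`, the underlying set of the group `G = (F_q^5, ·)`. -/
abbrev Tup (F : Type) : Type := F × F × F × F × F

/-- The group operation
`X·Y = (x₁+y₁, x₂+y₂, x₃+y₃, x₄+y₄+2x₁y₂, x₅+y₅+2x₁y₃)` of `G`. -/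
def gmul {F : Type} [Field F] (X Y : Tup F) : Tup F :=
  (X.1 + Y.1, X.2.1 + Y.2.1, X.2.2.1 + Y.2.2.1,
   X.2.2.2.1 + Y.2.2.2.1 + 2 * X.1 * Y.2.1,
   X.2.2.2.2 + Y.2.2.2.2 + 2 * X.1 * Y.2.2.1)

/-- The inverse in `G`: `X⁻¹ = (−x₁, −x₂, −x₃, −x₄+2x₁x₂, −x₅+2x₁x₃)`. -/
def ginv {F : Type} [Field F] (X : Tup F) : Tup F :=
  (-X.1, -X.2.1, -X.2.2.1, -X.2.2.2.1 + 2 * X.1 * X.2.1, -X.2.2.2.2 + 2 * X.1 * X.2.2.1)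

/-- The generating set `S = {(x, xa, xa², x²a, x²a²) : a, x ∈ F_q, x ≠ 0}`. -/
def Sset (F : Type) [Field F] : Set (Tup F) :=
  {g | ∃ a x : F, x ≠ 0 ∧ g = (x, x * a, x * a ^ 2, x ^ 2 * a, x ^ 2 * a ^ 2)}

/-- The adjacency relation of `Γ(q)`: a point `(p)` is adjacent to a line `[ℓ]` iff
`p₂+ℓ₂ = p₁ℓ₁`, `p₃+ℓ₃ = p₁ℓ₁²`, `p₄+ℓ₄ = p₁²ℓ₁`, `p₅+ℓ₅ = p₁²ℓ₁²`. -/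
def GAdj {F : Type} [Field F] (P L : Tup F) : Prop :=
  P.2.1 + L.2.1 = P.1 * L.1 ∧
  P.2.2.1 + L.2.2.1 = P.1 * L.1 ^ 2 ∧
  P.2.2.2.1 + L.2.2.2.1 = P.1 ^ 2 * L.1 ∧
  P.2.2.2.2 + L.2.2.2.2 = P.1 ^ 2 * L.1 ^ 2

/-- Let `q = p^e` with `p` an odd prime.  Then (i) `S = S⁻¹`, and (ii) two distinct points
`P, R ∈ F_q^5` are adjacent in the halved graph `Γ^(2)(q)` (i.e. they have a common line
as a neighbour in `Γ(q)`) if and only if `P = R·s` for some `s ∈ S`.  Consequently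
`Γ^(2)(q)` is the undirected Cayley graph `Cay(G, S)`. -/
theorem stmt_3 (p e : ℕ) (hp : p.Prime) (hodd : p ≠ 2) (he : 0 < e)
    (F : Type) [Field F] [Fintype F]
    (hcard : Fintype.card F = p ^ e) :
    (∀ g : Tup F, g ∈ Sset F ↔ ginv g ∈ Sset F) ∧
    (∀ P R : Tup F, P ≠ R →
      ((∃ L : Tup F, GAdj P L ∧ GAdj R L) ↔ ∃ s ∈ Sset F, P = gmul R s)) := by
  have key : ∀ g : Tup F, g ∈ Sset F → ginv g ∈ Sset F := by
    rintro g ⟨a, x, hx, rfl⟩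
    refine ⟨a, -x, neg_ne_zero.mpr hx, ?_⟩
    simp only [ginv, Prod.mk.injEq]
    refine ⟨?_, ?_, ?_, ?_, ?_⟩ <;> first | trivial | ring
  refine ⟨fun g => ⟨key g, fun h => ?_⟩, ?_⟩
  · have h2 := key _ h
    have h3 : ginv (ginv g) = g := by
      obtain ⟨g1, g2, g3, g4, g5⟩ := g
      simp only [ginv, Prod.mk.injEq]
      refine ⟨?_, ?_, ?_, ?_, ?_⟩ <;> ring
    rwa [h3] at h2
  · rintro ⟨p1, p2, p3, p4, p5⟩ ⟨r1, r2, r3, r4, r5⟩ hne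
    constructor
    · rintro ⟨⟨a, l2, l3, l4, l5⟩, ⟨h2, h3, h4, h5⟩, ⟨k2, k3, k4, k5⟩⟩
      dsimp only at h2 h3 h4 h5 k2 k3 k4 k5
      refine ⟨_, ⟨a, p1 - r1, ?_, rfl⟩, ?_⟩
      · intro h0
        have h1 : p1 = r1 := sub_eq_zero.mp h0
        subst h1
        apply hne
        simp only [Prod.mk.injEq]
        refine ⟨trivial, ?_, ?_, ?_, ?_⟩
        · linear_combination h2 - k2
        · linear_combination h3 - k3
        · linear_combination h4 - k4
        · linear_combination h5 - k5
      · simp only [gmul, Prod.mk.injEq]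
        refine ⟨?_, ?_, ?_, ?_, ?_⟩
        · ring
        · linear_combination h2 - k2
        · linear_combination h3 - k3
        · linear_combination h4 - k4
        · linear_combination h5 - k5
    · rintro ⟨s, ⟨a, x, hx, rfl⟩, h⟩
      simp only [gmul, Prod.mk.injEq] at h
      obtain ⟨rfl, rfl, rfl, rfl, rfl⟩ := h
      refine ⟨(a, r1 * a - r2, r1 * a ^ 2 - r3, r1 ^ 2 * a - r4, r1 ^ 2 * a ^ 2 - r5), ?_, ?_⟩ <;>
      · simp only [GAdj]
        refine ⟨?_, ?_, ?_, ?_⟩ <;> ring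
end

section
/- Let q = p^e be an odd prime power and let α, β, γ ∈ F_q with α ≠ 0. Then for all X, Y ∈ G one has M_{α,β,γ}(X·Y) = M_{α,β,γ}(X)·M_{α,β,γ}(Y); that is, M_{α,β,γ} is a q-dimensional complex matrix representation of the group G. -/
/-- `zetaTr p F c = ζ^{tr(c)} = e^{2πi·tr(c)/p}`, where `tr : F_q → F_p` is the absolute trace. -/
noncomputable def zetaTr (p : ℕ) (F : Type) [Field F] [Fintype F] [Algebra (ZMod p) F]
    (c : F) : ℂ :=
  Complex.exp (2 * Real.pi * Complex.I * ((Algebra.trace (ZMod p) F c).val : ℂ) / (p : ℂ))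

/-- The `q×q` complex matrix `M_{α,β,γ}(X)`, indexed by `F_q`, whose `(j,k)` entry is
`ζ^{tr((x₂ + (β/α)x₃)·j + α·x₄ + β·x₅ + γ·x₃)}` if `k = 2x₁α + j`, and `0` otherwise. -/
noncomputable def Mrep (p : ℕ) (F : Type) [Field F] [Fintype F] [DecidableEq F]
    [Algebra (ZMod p) F] (α β γ : F) (X : Tup F) : Matrix F F ℂ :=
  Matrix.of fun j k =>
    if k = 2 * X.1 * α + j then
      zetaTr p F ((X.2.1 + (β / α) * X.2.2.1) * j +
        α * X.2.2.2.1 + β * X.2.2.2.2 + γ * X.2.2.1)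
    else 0

theorem zetaTr_eq_stdAddChar (p : ℕ) [NeZero p] (F : Type) [Field F] [Fintype F]
    [Algebra (ZMod p) F] (c : F) :
    zetaTr p F c = ZMod.stdAddChar (Algebra.trace (ZMod p) F c) := by
  rw [ZMod.stdAddChar_apply, ZMod.toCircle_apply, zetaTr]

theorem zetaTr_add (p : ℕ) [NeZero p] (F : Type) [Field F] [Fintype F]
    [Algebra (ZMod p) F] (c d : F) :
    zetaTr p F (c + d) = zetaTr p F c * zetaTr p F d := by
  simp only [zetaTr_eq_stdAddChar, map_add, AddChar.map_add_eq_mul]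

/-- Let `q = p^e` be an odd prime power and `α, β, γ ∈ F_q` with `α ≠ 0`.  Then
`M_{α,β,γ}(X·Y) = M_{α,β,γ}(X)·M_{α,β,γ}(Y)` for all `X, Y ∈ G`; i.e. `M_{α,β,γ}` is a
`q`-dimensional complex matrix representation of `G`. -/
theorem stmt_7 (p e : ℕ) (hp : p.Prime) (hodd : p ≠ 2) (he : 0 < e)
    (F : Type) [Field F] [Fintype F] [DecidableEq F] [Algebra (ZMod p) F]
    (hcard : Fintype.card F = p ^ e)
    (α β γ : F) (hα : α ≠ 0) :
    ∀ X Y : Tup F, Mrep p F α β γ (gmul X Y) = Mrep p F α β γ X * Mrep p F α β γ Y := by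
  intro X Y
  have : NeZero p := ⟨hp.ne_zero⟩
  ext j k
  rw [Matrix.mul_apply, Finset.sum_eq_single (2 * X.1 * α + j)]
  · have hk : (2 * (X.1 + Y.1) * α + j) = 2 * Y.1 * α + (2 * X.1 * α + j) := by ring
    by_cases h : k = 2 * Y.1 * α + (2 * X.1 * α + j)
    · have h' : k = 2 * (gmul X Y).1 * α + j := h.trans hk.symm
      simp only [Mrep, Matrix.of_apply]
      rw [if_pos h', if_pos trivial, if_pos h, ← zetaTr_add]
      congr 1
      simp only [gmul]
      field_simp
      ring
    · have h' : ¬ k = 2 * (gmul X Y).1 * α + j := fun h2 => h (h2.trans hk)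
      simp only [Mrep, Matrix.of_apply]
      rw [if_neg h', if_neg h, mul_zero]
  · intro b _ hb
    simp only [Mrep, Matrix.of_apply]
    rw [if_neg hb, zero_mul]
  · intro h
    exact absurd (Finset.mem_univ _) h
end

section
/- Let q = p^e be an odd prime power. For α, β, γ ∈ F_q with α ≠ 0 define ψ_{α,β,γ}(X) = Tr(M_{α,β,γ}(X)). Then for all α, α' ≠ 0 and all β, γ, β', γ' ∈ F_q, (1/q⁵)·∑_{X ∈ F_q^5} ψ_{α,β,γ}(X)·conj(ψ_{α',β',γ'}(X)) equals 1 if (α,β,γ) = (α',β',γ') and equals 0 otherwise. In particular the characters ψ_{α,β,γ} are irreducible and pairwise inequivalent. -/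
/-- The character `ψ_{α,β,γ}(X) = Tr(M_{α,β,γ}(X))`. -/
noncomputable def psi (p : ℕ) (F : Type) [Field F] [Fintype F] [DecidableEq F]
    [Algebra (ZMod p) F] (α β γ : F) (X : Tup F) : ℂ :=
  Matrix.trace (Mrep p F α β γ X)

/-- The additive character `c ↦ ζ^{tr c}`. -/
noncomputable def chiTr (p : ℕ) (F : Type) [Field F] [Fintype F] [Algebra (ZMod p) F]
    [NeZero p] : AddChar F ℂ :=
  (ZMod.stdAddChar (N := p)).compAddMonoidHom (Algebra.trace (ZMod p) F).toAddMonoidHom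

lemma zetaTr_eq_chi (p : ℕ) (F : Type) [Field F] [Fintype F] [Algebra (ZMod p) F]
    [NeZero p] (c : F) : zetaTr p F c = chiTr p F c := by
  have h : chiTr p F c = ZMod.stdAddChar (Algebra.trace (ZMod p) F c) := rfl
  rw [h, ZMod.stdAddChar_apply, ZMod.toCircle_apply, zetaTr]

lemma chi_prim (p : ℕ) (F : Type) [Field F] [Fintype F] [Algebra (ZMod p) F]
    [Fact p.Prime] : (chiTr p F).IsPrimitive := by
  apply AddChar.IsPrimitive.of_ne_one
  intro h
  obtain ⟨c, hc⟩ := Algebra.trace_surjective (ZMod p) F 1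
  have h1 : ZMod.stdAddChar (Algebra.trace (ZMod p) F c) = (1 : ℂ) := by
    have : chiTr p F c = 1 := by rw [h]; rfl
    exact this
  rw [hc, ← AddChar.map_zero_eq_one (ZMod.stdAddChar (N := p))] at h1
  exact one_ne_zero (ZMod.injective_stdAddChar h1)

lemma chi_sum (p : ℕ) (F : Type) [Field F] [Fintype F] [DecidableEq F] [Algebra (ZMod p) F]
    [Fact p.Prime] (a : F) :
    ∑ x : F, chiTr p F (a * x) = if a = 0 then (Fintype.card F : ℂ) else 0 := by
  have := AddChar.sum_mulShift a (chi_prim p F)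
  simp only [mul_comm a]
  rw [this]
  split_ifs <;> simp

lemma psi_eq (p : ℕ) (F : Type) [Field F] [Fintype F] [DecidableEq F] [Algebra (ZMod p) F]
    [Fact p.Prime] (h2 : (2 : F) ≠ 0) (α β γ : F) (hα : α ≠ 0) (x₁ x₂ x₃ x₄ x₅ : F) :
    psi p F α β γ (x₁, x₂, x₃, x₄, x₅) =
      if x₁ = 0 then (if x₂ + (β / α) * x₃ = 0 then (Fintype.card F : ℂ) else 0) *
        (chiTr p F (α * x₄) * chiTr p F (β * x₅) * chiTr p F (γ * x₃)) else 0 := by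
  simp only [psi, Mrep, Matrix.trace, Matrix.diag, Matrix.of_apply, zetaTr_eq_chi]
  by_cases h : x₁ = 0
  · subst h
    rw [← chi_sum p, Finset.sum_mul]
    simp [AddChar.map_add_eq_mul, mul_assoc]
  · rw [if_neg h]
    apply Finset.sum_eq_zero
    intro j _
    rw [if_neg]
    intro hj
    have : 2 * x₁ * α = 0 := by linear_combination -hj
    exact mul_ne_zero (mul_ne_zero h2 h) hα this

/-- Let `q = p^e` be an odd prime power.  For all `α, α' ≠ 0` and all `β, γ, β', γ' ∈ F_q`,
`(1/q⁵)·∑_{X ∈ F_q^5} ψ_{α,β,γ}(X)·conj(ψ_{α',β',γ'}(X))` equals `1` if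
`(α,β,γ) = (α',β',γ')` and `0` otherwise; in particular the characters `ψ_{α,β,γ}` are
irreducible and pairwise inequivalent. -/
theorem stmt_9 (p e : ℕ) (hp : p.Prime) (hodd : p ≠ 2) (he : 0 < e)
    (F : Type) [Field F] [Fintype F] [DecidableEq F] [Algebra (ZMod p) F]
    (hcard : Fintype.card F = p ^ e)
    (α β γ α' β' γ' : F) (hα : α ≠ 0) (hα' : α' ≠ 0) :
    (1 / (Fintype.card F : ℂ) ^ 5) *
      ∑ X : Tup F, psi p F α β γ X * (starRingEnd ℂ) (psi p F α' β' γ' X) =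
      if (α, β, γ) = (α', β', γ') then 1 else 0 := by
  have : Fact p.Prime := ⟨hp⟩
  have h2 : (2 : F) ≠ 0 := by
    intro h
    have : CharP F p := charP_of_injective_algebraMap (algebraMap (ZMod p) F).injective p
    have h' : ((2 : ℕ) : F) = 0 := by exact_mod_cast h
    rw [CharP.cast_eq_zero_iff F p] at h'
    exact hodd ((Nat.prime_dvd_prime_iff_eq hp Nat.prime_two).1 h')
  have hq : (Fintype.card F : ℂ) ≠ 0 := by simp
  set q : ℂ := (Fintype.card F : ℂ) with hqd
  have key : ∀ a b x : F, chiTr p F (a * x) * (starRingEnd ℂ) (chiTr p F (b * x)) =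
      chiTr p F ((a - b) * x) := by
    intro a b x
    rw [← AddChar.map_neg_eq_conj, ← AddChar.map_add_eq_mul]
    congr 1; ring
  have term : ∀ x₁ x₂ x₃ x₄ x₅ : F, psi p F α β γ (x₁, x₂, x₃, x₄, x₅) *
      (starRingEnd ℂ) (psi p F α' β' γ' (x₁, x₂, x₃, x₄, x₅)) =
      if x₁ = 0 then
        (if x₂ + (β / α) * x₃ = 0 then q else 0) * (if x₂ + (β' / α') * x₃ = 0 then q else 0) *
          chiTr p F ((γ - γ') * x₃) * (chiTr p F ((α - α') * x₄)) * chiTr p F ((β - β') * x₅)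
      else 0 := by
    intro x₁ x₂ x₃ x₄ x₅
    rw [psi_eq p F h2 α β γ hα, psi_eq p F h2 α' β' γ' hα']
    by_cases h : x₁ = 0
    · have hc : (starRingEnd ℂ) (if x₂ + (β' / α') * x₃ = 0 then q else 0) =
          if x₂ + (β' / α') * x₃ = 0 then q else 0 := by
        split_ifs <;> simp [hqd]
      simp only [if_pos h, map_mul, ← key, ← hqd, hc]
      ring
    · simp [h]
  have sumeq : ∑ X : Tup F, psi p F α β γ X * (starRingEnd ℂ) (psi p F α' β' γ' X) =
      (∑ x₂ : F, ∑ x₃ : F, (if x₂ + (β / α) * x₃ = 0 then q else 0) *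
        (if x₂ + (β' / α') * x₃ = 0 then q else 0) * chiTr p F ((γ - γ') * x₃)) *
      (∑ x₄ : F, chiTr p F ((α - α') * x₄)) * ∑ x₅ : F, chiTr p F ((β - β') * x₅) := by
    simp only [Tup, Fintype.sum_prod_type, term]
    rw [Finset.sum_eq_single 0 (by intro b _ hb; simp [hb]) (by simp)]
    simp only [if_true]
    rw [Finset.sum_mul, Finset.sum_mul]
    refine Finset.sum_congr rfl fun x₂ _ => ?_
    rw [Finset.sum_mul, Finset.sum_mul]
    refine Finset.sum_congr rfl fun x₃ _ => ?_
    rw [mul_assoc, Finset.sum_mul, Finset.mul_sum]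
    refine Finset.sum_congr rfl fun x₄ _ => ?_
    rw [← mul_assoc, Finset.mul_sum]
  rw [sumeq, chi_sum, chi_sum]
  by_cases ha : α = α'
  · by_cases hb : β = β'
    · subst ha hb
      have hin : ∀ x₃ : F, ∑ x₂ : F, (if x₂ + (β / α) * x₃ = 0 then q else 0) *
          (if x₂ + (β / α) * x₃ = 0 then q else 0) * chiTr p F ((γ - γ') * x₃) =
          q * q * chiTr p F ((γ - γ') * x₃) := by
        intro x₃
        rw [Finset.sum_eq_single (-((β / α) * x₃))]
        · simp
        · intro b _ hb
          rw [if_neg (fun h => hb (eq_neg_of_add_eq_zero_left h))]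
          simp
        · simp
      rw [Finset.sum_comm]
      simp only [hin, ← Finset.mul_sum, chi_sum]
      by_cases hc : γ = γ'
      · subst hc
        simp only [sub_self, if_true, ← hqd]
        field_simp
      · simp [hc, sub_eq_zero]
    · simp [hb, sub_eq_zero]
  · simp [ha, sub_eq_zero]
end

section
/- Let q = p^e be an odd prime power, let α, β, γ ∈ F_q with α ≠ 0, and write M = M_{α,β,γ}(S), F = F_α(j,k), G = G_{α,β,γ}(j,k). Then for all j, k ∈ F_q: M_{j,k} = η(G)·ζ^{−tr(F²/(4G))}·S_{y²} if G ≠ 0; M_{j,k} = 0 if G = 0 and F ≠ 0; M_{j,k} = 0 if j = k; and M_{j,k} = q in the remaining case (G = F = 0 and j ≠ k). -/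
/-- The quadratic character `η` of a finite field, extended by `η(0) = 0`, with values in `ℂ`. -/
noncomputable def eta (F : Type) [Field F] [Fintype F] [DecidableEq F] (a : F) : ℂ :=
  ((quadraticChar F a : ℤ) : ℂ)

/-- The quadratic Gauss sum `S_{y²} = ∑_{a ∈ F_q} ζ^{tr(a²)}`. -/
noncomputable def Sy2 (p : ℕ) (F : Type) [Field F] [Fintype F] [Algebra (ZMod p) F] : ℂ :=
  ∑ a : F, zetaTr p F (a ^ 2)

open scoped Classical in
/-- The generating set `S = {(x, xa, xa², x²a, x²a²) : a, x ∈ F_q, x ≠ 0}` as a finite set. -/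
noncomputable def Sfin (F : Type) [Field F] [Fintype F] : Finset (Tup F) :=
  Finset.univ.filter
    (fun g => ∃ a x : F, x ≠ 0 ∧ g = (x, x * a, x * a ^ 2, x ^ 2 * a, x ^ 2 * a ^ 2))

/-- `M_{α,β,γ}(S) = ∑_{g ∈ S} M_{α,β,γ}(g)`. -/
noncomputable def MS (p : ℕ) (F : Type) [Field F] [Fintype F] [DecidableEq F]
    [Algebra (ZMod p) F] (α β γ : F) : Matrix F F ℂ :=
  ∑ g ∈ Sfin F, Mrep p F α β γ g

/-- `F_α(j,k) = (k² − j²)/(4α)`. -/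
def Fa {F : Type} [Field F] (α j k : F) : F := (k ^ 2 - j ^ 2) / (4 * α)

/-- `G_{α,β,γ}(j,k) = (β(k² − j²) + 2γα(k − j))/(4α²)`. -/
def Ga {F : Type} [Field F] (α β γ j k : F) : F :=
  (β * (k ^ 2 - j ^ 2) + 2 * γ * α * (k - j)) / (4 * α ^ 2)

theorem exists_zetaTr_addChar (p : ℕ) (hp : p.Prime)
    (F : Type) [Field F] [Fintype F] [Algebra (ZMod p) F] :
    ∃ ψ : AddChar F ℂ, ψ.IsPrimitive ∧ ∀ c, zetaTr p F c = ψ c := by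
  have : Fact p.Prime := ⟨hp⟩
  refine ⟨(ZMod.stdAddChar (N := p)).compAddMonoidHom (Algebra.trace (ZMod p) F).toAddMonoidHom,
    AddChar.IsPrimitive.of_ne_one ?_, fun c => ?_⟩
  · obtain ⟨a, ha⟩ := Algebra.trace_surjective (ZMod p) F 1
    rw [AddChar.ne_one_iff]
    refine ⟨a, fun hf => ?_⟩
    have h1 : ZMod.stdAddChar (N := p) (Algebra.trace (ZMod p) F a) = 1 := hf
    rw [ha, ← (ZMod.stdAddChar (N := p)).map_zero_eq_one, ZMod.injective_stdAddChar.eq_iff] at h1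
    exact one_ne_zero h1
  · have h1 : (ZMod.stdAddChar (N := p)).compAddMonoidHom
      (Algebra.trace (ZMod p) F).toAddMonoidHom c
        = ZMod.stdAddChar (N := p) (Algebra.trace (ZMod p) F c) := rfl
    rw [h1, ZMod.stdAddChar_apply, ZMod.toCircle_apply]
    rfl

theorem sum_sq_eq (F : Type) [Field F] [Fintype F] [DecidableEq F] (h2 : ringChar F ≠ 2)
    (ψ : AddChar F ℂ) (hψ : ψ.IsPrimitive) (g : F) (hg : g ≠ 0) :
    ∑ b : F, ψ (g * b ^ 2) = ∑ t : F, eta F t * ψ (g * t) := by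
  have h0 : ∑ t : F, ψ (g * t) = 0 := by
    have := AddChar.sum_mulShift g hψ
    simpa [hg, mul_comm] using this
  rw [← Finset.sum_fiberwise_of_maps_to (s := Finset.univ) (t := Finset.univ)
    (g := fun b : F => b ^ 2) (fun _ _ => Finset.mem_univ _)]
  have : ∀ t : F, ∑ b ∈ Finset.univ.filter (fun b : F => b ^ 2 = t), ψ (g * b ^ 2)
      = eta F t * ψ (g * t) + ψ (g * t) := by
    intro t
    have h := quadraticChar_card_sqrts h2 t
    rw [Finset.sum_congr rfl (g := fun _ => ψ (g * t))
      (fun b hb => by rw [(Finset.mem_filter.1 hb).2])]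
    rw [Finset.sum_const, nsmul_eq_mul]
    have h' : ((Finset.univ.filter (fun b : F => b ^ 2 = t)).card : ℤ)
        = quadraticChar F t + 1 := by
      rw [← h]; congr 2; ext; simp
    have h'' : ((Finset.univ.filter (fun b : F => b ^ 2 = t)).card : ℂ) = eta F t + 1 := by
      unfold eta; exact_mod_cast h'
    rw [h'']; ring
  simp only [this, Finset.sum_add_distrib, h0, add_zero]

theorem sum_sq_scale (F : Type) [Field F] [Fintype F] [DecidableEq F] (h2 : ringChar F ≠ 2)
    (ψ : AddChar F ℂ) (hψ : ψ.IsPrimitive) (g : F) (hg : g ≠ 0) :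
    ∑ b : F, ψ (g * b ^ 2) = eta F g * ∑ b : F, ψ (b ^ 2) := by
  have h1 := sum_sq_eq F h2 ψ hψ 1 one_ne_zero
  simp only [one_mul] at h1
  rw [sum_sq_eq F h2 ψ hψ g hg, h1, Finset.mul_sum,
    ← Equiv.sum_comp (Equiv.mulLeft₀ g hg) (fun t => eta F g * (eta F t * ψ t))]
  refine Finset.sum_congr rfl fun t _ => ?_
  have hs : eta F g * eta F g = 1 := by
    have := quadraticChar_sq_one hg
    unfold eta
    rw [← sq]
    exact_mod_cast this
  have hm : eta F (g * t) = eta F g * eta F t := by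
    unfold eta; rw [map_mul]; push_cast; rfl
  simp only [Equiv.mulLeft₀_apply, hm]
  linear_combination (-(eta F t * ψ (g * t))) * hs

theorem mem_Sfin_iff (F : Type) [Field F] [Fintype F] (g : Tup F) :
    g ∈ Sfin F ↔ ∃ a x : F, x ≠ 0 ∧ g = (x, x * a, x * a ^ 2, x ^ 2 * a, x ^ 2 * a ^ 2) := by
  simp [Sfin]

theorem MS_diag (p : ℕ) (F : Type) [Field F] [Fintype F] [DecidableEq F] [Algebra (ZMod p) F]
    (h2 : (2 : F) ≠ 0) (α β γ : F) (hα : α ≠ 0) (j : F) : MS p F α β γ j j = 0 := by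
  unfold MS
  rw [Matrix.sum_apply]
  refine Finset.sum_eq_zero fun g hg => ?_
  obtain ⟨a, x, hx, rfl⟩ := (mem_Sfin_iff F g).1 hg
  simp [Mrep, h2, hx, hα]

theorem MS_off (p : ℕ) (F : Type) [Field F] [Fintype F] [DecidableEq F] [Algebra (ZMod p) F]
    (h2 : (2 : F) ≠ 0) (α β γ : F) (hα : α ≠ 0) (j k : F) (hjk : j ≠ k) :
    MS p F α β γ j k = ∑ a : F, zetaTr p F (Fa α j k * a + Ga α β γ j k * a ^ 2) := by
  have h4 : (4 : F) ≠ 0 := by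
    have : (4 : F) = 2 * 2 := by norm_num
    rw [this]; exact mul_ne_zero h2 h2
  unfold MS
  rw [Matrix.sum_apply]
  simp only [Mrep, Matrix.of_apply]
  rw [← Finset.sum_filter]
  symm
  have hx : (k - j) / (2 * α) ≠ 0 := div_ne_zero (sub_ne_zero.2 hjk.symm) (mul_ne_zero h2 hα)
  refine Finset.sum_nbij (fun a : F => ((k - j) / (2 * α), (k - j) / (2 * α) * a,
    (k - j) / (2 * α) * a ^ 2, ((k - j) / (2 * α)) ^ 2 * a, ((k - j) / (2 * α)) ^ 2 * a ^ 2))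
    ?_ ?_ ?_ ?_
  · intro a _
    rw [Finset.mem_filter]
    refine ⟨(mem_Sfin_iff F _).2 ⟨a, _, hx, rfl⟩, ?_⟩
    field_simp
    ring
  · intro a _ b _ hab
    simp only [Prod.mk.injEq] at hab
    exact mul_left_cancel₀ hx hab.2.1
  · intro g hg
    obtain ⟨hg1, hg2⟩ := Finset.mem_filter.1 (Finset.mem_coe.1 hg)
    obtain ⟨a, x, hx, rfl⟩ := (mem_Sfin_iff F g).1 hg1
    have : (k - j) / (2 * α) = x := by
      rw [div_eq_iff (mul_ne_zero h2 hα)]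
      simp only at hg2
      rw [hg2]; ring
    exact ⟨a, by simp, by simp only [this]⟩
  · intro a _
    congr 1
    simp only [Fa, Ga]
    have e4 : (4 : F) = 2 * 2 := by norm_num
    rw [e4]
    field_simp
    ring

/-- Let `q = p^e` be an odd prime power, `α, β, γ ∈ F_q` with `α ≠ 0`, and write
`M = M_{α,β,γ}(S)`, `F = F_α(j,k)`, `G = G_{α,β,γ}(j,k)`.  Then for all `j, k ∈ F_q`:
`M_{j,k} = η(G)·ζ^{−tr(F²/(4G))}·S_{y²}` if `G ≠ 0`; `M_{j,k} = 0` if `G = 0` and `F ≠ 0`;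
`M_{j,k} = 0` if `j = k`; and `M_{j,k} = q` in the remaining case. -/
theorem stmt_11 (p e : ℕ) (hp : p.Prime) (hodd : p ≠ 2) (he : 0 < e)
    (F : Type) [Field F] [Fintype F] [DecidableEq F] [Algebra (ZMod p) F]
    (hcard : Fintype.card F = p ^ e)
    (α β γ : F) (hα : α ≠ 0) (j k : F) :
    (Ga α β γ j k ≠ 0 →
      MS p F α β γ j k =
        eta F (Ga α β γ j k) * zetaTr p F (-(Fa α j k ^ 2 / (4 * Ga α β γ j k))) * Sy2 p F) ∧
    (Ga α β γ j k = 0 → Fa α j k ≠ 0 → MS p F α β γ j k = 0) ∧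
    (j = k → MS p F α β γ j k = 0) ∧
    (Ga α β γ j k = 0 → Fa α j k = 0 → j ≠ k → MS p F α β γ j k = (p : ℂ) ^ e) := by
  have : Fact p.Prime := ⟨hp⟩
  have : CharP F p := charP_of_injective_algebraMap (algebraMap (ZMod p) F).injective p
  have hr : ringChar F ≠ 2 := by rw [ringChar.eq F p]; exact hodd
  have h2 : (2 : F) ≠ 0 := Ring.two_ne_zero hr
  obtain ⟨ψ, hψ, hz⟩ := exists_zetaTr_addChar p hp F
  have h4 : (4 : F) ≠ 0 := by
    have : (4 : F) = 2 * 2 := by norm_num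
    rw [this]; exact mul_ne_zero h2 h2
  refine ⟨fun hG => ?_, fun hG hF => ?_, fun h => ?_, fun hG hF hjk => ?_⟩
  · have hjk : j ≠ k := by
      rintro rfl
      exact hG (by simp [Ga])
    rw [MS_off p F h2 α β γ hα j k hjk]
    simp only [Sy2, hz]
    generalize Ga α β γ j k = G at *
    generalize Fa α j k = f
    rw [mul_right_comm, ← sum_sq_scale F hr ψ hψ G hG,
      ← Equiv.sum_comp (Equiv.addRight (f / (2 * G))) (fun b => ψ (G * b ^ 2)), Finset.sum_mul]
    refine Finset.sum_congr rfl fun a _ => ?_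
    rw [← AddChar.map_add_eq_mul]
    congr 1
    simp only [Equiv.coe_addRight]
    have e4 : (4 : F) = 2 * 2 := by norm_num
    rw [e4]
    field_simp
    ring
  · have hjk : j ≠ k := by
      rintro rfl
      exact hF (by simp [Fa])
    rw [MS_off p F h2 α β γ hα j k hjk]
    have := AddChar.sum_mulShift (Fa α j k) hψ
    simpa [hG, hz, hF, mul_comm] using this
  · subst h
    exact MS_diag p F h2 α β γ hα j
  · rw [MS_off p F h2 α β γ hα j k hjk]
    simp [hG, hF, hz, hcard]
end

section
/- Let q = p^e be an odd prime power, let α, β ∈ F_q^* and γ ∈ F_q. Then M_{α,β,γ}(S) = M_{1,β,αγ}(S). -/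
/-- Let `q = p^e` be an odd prime power, `α, β ∈ F_q^*` and `γ ∈ F_q`.  Then
`M_{α,β,γ}(S) = M_{1,β,αγ}(S)`. -/
theorem stmt_12 (p e : ℕ) (hp : p.Prime) (hodd : p ≠ 2) (he : 0 < e)
    (F : Type) [Field F] [Fintype F] [DecidableEq F] [Algebra (ZMod p) F]
    (hcard : Fintype.card F = p ^ e)
    (α β γ : F) (hα : α ≠ 0) (hβ : β ≠ 0) :
    MS p F α β γ = MS p F 1 β (α * γ) := by
  unfold MS
  refine Finset.sum_nbij'
    (fun g => (α * g.1, g.2.1, g.2.2.1 / α, α * g.2.2.2.1, g.2.2.2.2))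
    (fun g => (g.1 / α, g.2.1, α * g.2.2.1, g.2.2.2.1 / α, g.2.2.2.2)) ?_ ?_ ?_ ?_ ?_
  · intro g hg
    simp only [Sfin, Finset.mem_filter, Finset.mem_univ, true_and] at hg ⊢
    obtain ⟨a, x, hx, rfl⟩ := hg
    refine ⟨a / α, α * x, mul_ne_zero hα hx, ?_⟩
    simp only [Prod.mk.injEq]
    refine ⟨trivial, ?_, ?_, ?_, ?_⟩ <;> field_simp
  · intro g hg
    simp only [Sfin, Finset.mem_filter, Finset.mem_univ, true_and] at hg ⊢
    obtain ⟨a, x, hx, rfl⟩ := hg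
    refine ⟨a * α, x / α, div_ne_zero hx hα, ?_⟩
    simp only [Prod.mk.injEq]
    refine ⟨trivial, ?_, ?_, ?_, ?_⟩ <;> field_simp
  · rintro ⟨a, b, c, d, f⟩ _
    simp only [Prod.mk.injEq]
    refine ⟨?_, trivial, ?_, ?_, trivial⟩ <;> field_simp
  · rintro ⟨a, b, c, d, f⟩ _
    simp only [Prod.mk.injEq]
    refine ⟨?_, trivial, ?_, ?_, trivial⟩ <;> field_simp
  · rintro ⟨a, b, c, d, f⟩ _
    ext j k
    simp only [Mrep, Matrix.of_apply]
    have h1 : 2 * (α * a) * 1 + j = 2 * a * α + j := by ring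
    have h2 : (b + β / 1 * (c / α)) * j + 1 * (α * d) + β * f + α * γ * (c / α)
        = (b + β / α * c) * j + α * d + β * f + γ * c := by
      field_simp
    rw [h1, h2]
end

section
/- Let q = p^e be an odd prime power and β ∈ F_q^*. Then for all j, k ∈ F_q, the (j,k) entry of M_{1,β,0}(S) equals S_{y²}·ζ^{tr((j² − k²)/(16β))}·(U_β)_{j,k}. Equivalently, M_{1,β,0}(S) = S_{y²}·Δ·U_β·Δ⁻¹ where Δ is the diagonal matrix with Δ_{j,j} = ζ^{tr(j²/(16β))}; in particular M_{1,β,0}(S) is similar to S_{y²}·U_β. -/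
/-- The matrix `U_β`: `(U_β)_{j,k} = η(−1)·S_{y²}` if `j = −k` and `j ≠ 0`, and
`(U_β)_{j,k} = η(β(k² − j²))` otherwise. -/
noncomputable def Umat (p : ℕ) (F : Type) [Field F] [Fintype F] [DecidableEq F]
    [Algebra (ZMod p) F] (β : F) : Matrix F F ℂ :=
  Matrix.of fun j k =>
    if j = -k ∧ j ≠ 0 then eta F (-1) * Sy2 p F else eta F (β * (k ^ 2 - j ^ 2))

/-- The additive character `c ↦ ζ^{tr c}`. -/
noncomputable def psiChar (p : ℕ) [NeZero p] (F : Type) [Field F] [Fintype F]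
    [Algebra (ZMod p) F] : AddChar F ℂ :=
  (ZMod.stdAddChar (N := p)).compAddMonoidHom (Algebra.trace (ZMod p) F).toAddMonoidHom

theorem zetaTr_eq_psi (p : ℕ) [NeZero p] (F : Type) [Field F] [Fintype F]
    [Algebra (ZMod p) F] (c : F) : zetaTr p F c = psiChar p F c := by
  have h := ZMod.stdAddChar_coe (N := p) ((Algebra.trace (ZMod p) F c).val : ℤ)
  rw [Int.cast_natCast, ZMod.natCast_zmod_val] at h
  simp only [zetaTr, psiChar, AddChar.compAddMonoidHom_apply]
  refine Eq.trans ?_ h.symm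
  simp

theorem psi_primitive (p : ℕ) [hp : Fact p.Prime] (F : Type) [Field F] [Fintype F]
    [Algebra (ZMod p) F] : (psiChar p F).IsPrimitive := by
  intro a ha h
  have htr := (traceForm_nondegenerate (ZMod p) F).1 a
  refine ha (htr fun b => ?_)
  have h2 := DFunLike.congr_fun h b
  simp only [psiChar, AddChar.mulShift_apply, AddChar.one_apply,
    AddChar.compAddMonoidHom_apply] at h2
  rw [← (ZMod.stdAddChar (N := p)).map_zero_eq_one] at h2
  exact ZMod.injective_stdAddChar h2

/-- The quadratic character with values in `ℂ`. -/
noncomputable def etaChar (F : Type) [Field F] [Fintype F] [DecidableEq F] : MulChar F ℂ :=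
  (quadraticChar F).ringHomComp (Int.castRingHom ℂ)

theorem eta_eq (F : Type) [Field F] [Fintype F] [DecidableEq F] (a : F) :
    eta F a = etaChar F a := rfl

theorem sum_sq (F : Type) [Field F] [Fintype F] [DecidableEq F] (hF : ringChar F ≠ 2)
    (ψ : AddChar F ℂ) (hψ : ψ.IsPrimitive) (c : F) (hc : c ≠ 0) :
    ∑ y : F, ψ (c * y ^ 2) = etaChar F c * gaussSum (etaChar F) ψ := by
  have h1 : ∑ y : F, ψ (c * y ^ 2) = ∑ t : F, (etaChar F t + 1) * ψ (c * t) := by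
    rw [← Finset.sum_fiberwise (s := Finset.univ) (g := fun y : F => y ^ 2)]
    refine Finset.sum_congr rfl fun t _ => ?_
    rw [Finset.sum_congr rfl (g := fun _ => ψ (c * t))
      (by intro y hy; rw [(Finset.mem_filter.1 hy).2])]
    rw [Finset.sum_const, nsmul_eq_mul]
    congr 1
    have h := quadraticChar_card_sqrts hF t
    have h' := congrArg (Int.cast : ℤ → ℂ) h
    push_cast at h'
    refine Eq.trans ?_ h'
    congr 2
    ext y
    simp
  have h2 : ∑ t : F, ψ (c * t) = 0 := by
    have := AddChar.sum_mulShift c hψ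
    simpa [hc, mul_comm] using this
  have h3 := gaussSum_mulShift (etaChar F) ψ (Units.mk0 c hc)
  have h4 : etaChar F c * etaChar F c = 1 := by
    have h := quadraticChar_sq_one hc
    have h' := congrArg (Int.cast : ℤ → ℂ) h
    push_cast at h'
    rw [← eta_eq, eta, ← sq, h']
  rw [h1]
  simp only [add_mul, one_mul, Finset.sum_add_distrib, h2, add_zero]
  rw [← h3]
  simp only [Units.val_mk0]
  rw [← mul_assoc, h4, one_mul]
  rfl

theorem etaChar_sq (F : Type) [Field F] [Fintype F] [DecidableEq F] {c : F} (hc : c ≠ 0) :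
    etaChar F (c ^ 2) = 1 := by
  rw [← eta_eq, eta, quadraticChar_sq_one' hc]
  simp

theorem entry (F : Type) [Field F] [Fintype F] [DecidableEq F] (hF : ringChar F ≠ 2)
    (ψ : AddChar F ℂ) (hψ : ψ.IsPrimitive) (c β : F) (hc : c ≠ 0) (hβ : β ≠ 0) :
    ∑ a : F, ψ (c * (a + β * a ^ 2)) =
      gaussSum (etaChar F) ψ * ψ (-(c / (4 * β))) * etaChar F (β * c) := by
  have h2 : (2 : F) ≠ 0 := Ring.two_ne_zero hF
  have h := sum_sq F hF ψ hψ (β * c) (mul_ne_zero hβ hc)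
  rw [← Equiv.sum_comp (Equiv.addRight (1 / (2 * β)))] at h
  have h4 : (4 : F) ≠ 0 := by
    have : (4 : F) = 2 * 2 := by norm_num
    rw [this]; exact mul_ne_zero h2 h2
  have key : ∀ a : F, ψ (c * (a + β * a ^ 2)) =
      ψ (-(c / (4 * β))) * ψ (β * c * (Equiv.addRight (1 / (2 * β)) a) ^ 2) := by
    intro a
    rw [← AddChar.map_add_eq_mul]
    congr 1
    simp only [Equiv.coe_addRight]
    field_simp
    ring
  simp only [key, ← Finset.mul_sum, h]
  ring

theorem MS_entry (p : ℕ) (F : Type) [Field F] [Fintype F] [DecidableEq F]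
    [Algebra (ZMod p) F] (h2 : (2 : F) ≠ 0) (β j k : F) :
    MS p F 1 β 0 j k = if j = k then 0 else
      ∑ a : F, zetaTr p F ((k ^ 2 - j ^ 2) / 4 * (a + β * a ^ 2)) := by
  have h4 : (4 : F) ≠ 0 := by
    have : (4 : F) = 2 * 2 := by norm_num
    rw [this]; exact mul_ne_zero h2 h2
  have hS : Sfin F = ((Finset.univ : Finset F) ×ˢ (Finset.univ.filter fun x : F => x ≠ 0)).image
      (fun ax : F × F => ((ax.2, ax.2 * ax.1, ax.2 * ax.1 ^ 2, ax.2 ^ 2 * ax.1,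
        ax.2 ^ 2 * ax.1 ^ 2) : Tup F)) := by
    ext g
    simp only [Sfin, Finset.mem_filter, Finset.mem_univ, true_and, Finset.mem_image,
      Finset.mem_product, Prod.exists]
    constructor
    · rintro ⟨a, x, hx, rfl⟩
      exact ⟨a, x, hx, rfl⟩
    · rintro ⟨a, x, hx, rfl⟩
      exact ⟨a, x, hx, rfl⟩
  rw [MS, Matrix.sum_apply, hS, Finset.sum_image]
  · rw [Finset.sum_product]
    simp only [Mrep, Matrix.of_apply]
    split_ifs with hjk
    · subst hjk
      refine Finset.sum_eq_zero fun a _ => Finset.sum_eq_zero fun x hx => ?_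
      have hx' := (Finset.mem_filter.1 hx).2
      rw [if_neg]
      intro h
      have : 2 * x = 0 := by linear_combination -h
      exact hx' ((mul_eq_zero.1 this).resolve_left h2)
    · refine Finset.sum_congr rfl fun a _ => ?_
      rw [Finset.sum_eq_single ((k - j) / 2)]
      · rw [if_pos (by field_simp; ring)]
        congr 1
        field_simp
        ring
      · intro x _ hx
        rw [if_neg]
        intro h
        apply hx
        rw [h]
        field_simp
        ring
      · intro h
        exfalso
        apply h
        simp only [Finset.mem_filter, Finset.mem_univ, true_and]
        exact div_ne_zero (sub_ne_zero.2 (Ne.symm hjk)) h2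
  · rintro ⟨a, x⟩ hx ⟨b, y⟩ hy h
    have hx' : x ≠ 0 := by simpa using hx
    simp only [Prod.mk.injEq] at h
    obtain ⟨rfl, h, -⟩ := h
    rw [mul_left_cancel₀ hx' h]

theorem main_entry (p e : ℕ) (hp : p.Prime) (hodd : p ≠ 2)
    (F : Type) [Field F] [Fintype F] [DecidableEq F] [Algebra (ZMod p) F]
    (β : F) (hβ : β ≠ 0) (j k : F) :
      MS p F 1 β 0 j k =
        Sy2 p F * zetaTr p F ((j ^ 2 - k ^ 2) / (16 * β)) * Umat p F β j k := by
  haveI : Fact p.Prime := ⟨hp⟩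
  haveI : CharP F p := charP_of_injective_algebraMap (algebraMap (ZMod p) F).injective p
  have hF : ringChar F ≠ 2 := by rwa [ringChar.eq F p]
  have h2 : (2 : F) ≠ 0 := Ring.two_ne_zero hF
  have h4 : (4 : F) ≠ 0 := by
    have : (4 : F) = 2 * 2 := by norm_num
    rw [this]; exact mul_ne_zero h2 h2
  have hψ := psi_primitive p F
  have hone : etaChar F 1 = 1 := map_one _
  have hSy : Sy2 p F = gaussSum (etaChar F) (psiChar p F) := by
    have := sum_sq F hF _ hψ 1 one_ne_zero
    simp only [one_mul, hone] at this
    simp only [Sy2, zetaTr_eq_psi, this]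
  rw [MS_entry p F h2, Umat, Matrix.of_apply]
  simp only [zetaTr_eq_psi, eta_eq]
  by_cases hjk : j = k
  · subst hjk
    rw [if_pos rfl, if_neg]
    · rw [sub_self, mul_zero, MulChar.map_zero, mul_zero]
    · rintro ⟨h, h0⟩
      have : 2 * j = 0 := by linear_combination h
      exact h0 ((mul_eq_zero.1 this).resolve_left h2)
  rw [if_neg hjk]
  by_cases hjk' : j = -k
  · have hj0 : j ≠ 0 := by
      rintro rfl
      exact hjk (by linear_combination -hjk')
    rw [if_pos ⟨hjk', hj0⟩, hjk']
    have hq : etaChar F ≠ 1 := by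
      obtain ⟨a, ha⟩ := quadraticChar_exists_neg_one hF
      intro h
      have ha0 : a ≠ 0 := by rintro rfl; simp at ha
      have h1 := DFunLike.congr_fun h a
      rw [← eta_eq, eta, ha, MulChar.one_apply ha0.isUnit] at h1
      norm_num at h1
    have hquad : (etaChar F).IsQuadratic := (quadraticChar_isQuadratic F).comp _
    have hsq := gaussSum_sq hq hquad hψ
    have hneg : etaChar F (-1) * etaChar F (-1) = 1 := by
      rw [← map_mul]; simp
    simp only [neg_sq, sub_self, zero_div, zero_mul, AddChar.map_zero_eq_one, mul_one]
    rw [hSy, mul_left_comm, ← sq, hsq, ← mul_assoc, hneg]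
    simp
  · rw [if_neg (fun h => hjk' h.1)]
    have hc : (k ^ 2 - j ^ 2) / 4 ≠ 0 := by
      refine div_ne_zero ?_ h4
      have : k ^ 2 - j ^ 2 = (k - j) * (j + k) := by ring
      rw [this]
      refine mul_ne_zero (sub_ne_zero.2 (Ne.symm hjk)) fun h => hjk' ?_
      linear_combination h
    rw [entry F hF _ hψ _ β hc hβ, hSy]
    have e1 : -((k ^ 2 - j ^ 2) / 4 / (4 * β)) = (j ^ 2 - k ^ 2) / (16 * β) := by
      rw [div_div, ← neg_div, show 4 * (4 * β) = 16 * β by ring, neg_sub]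
    have e2 : β * (k ^ 2 - j ^ 2) = β * ((k ^ 2 - j ^ 2) / 4) * 2 ^ 2 := by
      field_simp
      ring
    rw [e1, e2, map_mul (etaChar F) _ (2 ^ 2), etaChar_sq F h2, mul_one]

/-- Let `q = p^e` be an odd prime power and `β ∈ F_q^*`.  Then for all `j, k ∈ F_q` the
`(j,k)` entry of `M_{1,β,0}(S)` equals `S_{y²}·ζ^{tr((j² − k²)/(16β))}·(U_β)_{j,k}`;
equivalently `M_{1,β,0}(S) = S_{y²}·Δ·U_β·Δ⁻¹` where `Δ` is the diagonal matrix with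
`Δ_{j,j} = ζ^{tr(j²/(16β))}`; in particular `M_{1,β,0}(S)` is similar to `S_{y²}·U_β`. -/
theorem stmt_13 (p e : ℕ) (hp : p.Prime) (hodd : p ≠ 2) (he : 0 < e)
    (F : Type) [Field F] [Fintype F] [DecidableEq F] [Algebra (ZMod p) F]
    (hcard : Fintype.card F = p ^ e)
    (β : F) (hβ : β ≠ 0) :
    (∀ j k : F,
      MS p F 1 β 0 j k =
        Sy2 p F * zetaTr p F ((j ^ 2 - k ^ 2) / (16 * β)) * Umat p F β j k) ∧
    MS p F 1 β 0 =
      Sy2 p F •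
        (Matrix.diagonal (fun j : F => zetaTr p F (j ^ 2 / (16 * β))) * Umat p F β *
          Matrix.diagonal (fun j : F => zetaTr p F (-(j ^ 2 / (16 * β))))) ∧
    (∃ P : Matrix F F ℂ, IsUnit P.det ∧
      MS p F 1 β 0 = P * (Sy2 p F • Umat p F β) * P⁻¹) := by
  haveI : Fact p.Prime := ⟨hp⟩
  have H := main_entry p e hp hodd F β hβ
  have hD : MS p F 1 β 0 =
      Sy2 p F •
        (Matrix.diagonal (fun j : F => zetaTr p F (j ^ 2 / (16 * β))) * Umat p F β *
          Matrix.diagonal (fun j : F => zetaTr p F (-(j ^ 2 / (16 * β))))) := by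
    ext j k
    rw [H, Matrix.smul_apply, Matrix.mul_diagonal, Matrix.diagonal_mul, smul_eq_mul,
      sub_div, sub_eq_add_neg, zetaTr_eq_psi, AddChar.map_add_eq_mul]
    simp only [zetaTr_eq_psi]
    ring
  have hinv : Matrix.diagonal (fun j : F => zetaTr p F (j ^ 2 / (16 * β))) *
      Matrix.diagonal (fun j : F => zetaTr p F (-(j ^ 2 / (16 * β)))) = 1 := by
    rw [Matrix.diagonal_mul_diagonal, ← Matrix.diagonal_one]
    congr 1
    ext j
    rw [zetaTr_eq_psi, zetaTr_eq_psi, ← AddChar.map_add_eq_mul, add_neg_cancel,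
      AddChar.map_zero_eq_one]
  refine ⟨H, hD, Matrix.diagonal (fun j : F => zetaTr p F (j ^ 2 / (16 * β))), ?_, ?_⟩
  · exact Matrix.isUnit_det_of_right_inverse hinv
  · rw [Matrix.inv_eq_right_inv hinv, hD, Matrix.mul_smul, Matrix.smul_mul]
end

section
/- Let q = p^e be an odd prime power, let τ, μ ∈ F_q with τ ≠ 0, and write N = N_{τ,μ}(S), F = F_{τ,μ}(j,k), G = G_τ(j,k). Then for all j, k ∈ F_q: N_{j,k} = η(G)·ζ^{−tr(F²/(4G))}·S_{y²} if G ≠ 0; N_{j,k} = 0 if G = 0 and F ≠ 0; N_{j,k} = 0 if j = k; and N_{j,k} = q in the remaining case (G = F = 0 and j ≠ k). -/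
/-- The `q×q` complex matrix `N_{τ,μ}(X)`, indexed by `F_q`, whose `(j,k)` entry is
`ζ^{tr(x₃·j + τ·x₅ + μ·x₂)}` if `k = 2x₁τ + j`, and `0` otherwise. -/
noncomputable def Nrep (p : ℕ) (F : Type) [Field F] [Fintype F] [DecidableEq F]
    [Algebra (ZMod p) F] (τ μ : F) (X : Tup F) : Matrix F F ℂ :=
  Matrix.of fun j k =>
    if k = 2 * X.1 * τ + j then
      zetaTr p F (X.2.2.1 * j + τ * X.2.2.2.2 + μ * X.2.1)
    else 0

/-- `N_{τ,μ}(S) = ∑_{g ∈ S} N_{τ,μ}(g)`. -/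
noncomputable def NS (p : ℕ) (F : Type) [Field F] [Fintype F] [DecidableEq F]
    [Algebra (ZMod p) F] (τ μ : F) : Matrix F F ℂ :=
  ∑ g ∈ Sfin F, Nrep p F τ μ g

/-- `F_{τ,μ}(j,k) = μ(k − j)/(2τ)`. -/
def Fn {F : Type} [Field F] (τ μ j k : F) : F := μ * (k - j) / (2 * τ)

/-- `G_τ(j,k) = (k² − j²)/(4τ)`. -/
def Gn {F : Type} [Field F] (τ j k : F) : F := (k ^ 2 - j ^ 2) / (4 * τ)

lemma aux_char (p : ℕ) (hp : p.Prime) (F : Type) [Field F] [Fintype F] [Algebra (ZMod p) F] :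
    ∃ ψ : AddChar F ℂ, ψ ≠ 1 ∧ ∀ c, zetaTr p F c = ψ c := by
  have : Fact p.Prime := ⟨hp⟩
  refine ⟨(ZMod.stdAddChar (N := p)).compAddMonoidHom
    (Algebra.trace (ZMod p) F).toAddMonoidHom, ?_, ?_⟩
  · intro h
    obtain ⟨c, hc⟩ := Algebra.trace_surjective (ZMod p) F 1
    have h1 := DFunLike.congr_fun h c
    have h2 : ZMod.stdAddChar (N := p) 1 = ZMod.stdAddChar (N := p) 0 := by
      simpa [hc] using h1
    exact one_ne_zero (ZMod.injective_stdAddChar h2)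
  · intro c
    simp [zetaTr, ZMod.stdAddChar_apply, ZMod.toCircle_apply]

lemma aux_sum_mul (F : Type) [Field F] [Fintype F] (ψ : AddChar F ℂ) (hψ : ψ ≠ 1)
    (b : F) (hb : b ≠ 0) : ∑ c, ψ (b * c) = 0 := by
  rw [← AddChar.sum_eq_zero_of_ne_one hψ]
  exact Fintype.sum_equiv (Equiv.mulLeft₀ b hb) _ _ (fun c => rfl)

lemma aux_sq (F : Type) [Field F] [Fintype F] [DecidableEq F] (h2 : ringChar F ≠ 2)
    (ψ : AddChar F ℂ) (hψ : ψ ≠ 1) (b : F) (hb : b ≠ 0) :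
    ∑ a, ψ (b * a ^ 2) = ∑ c, eta F c * ψ (b * c) := by
  have h : ∑ a, ψ (b * a ^ 2) = ∑ c, (eta F c + 1) * ψ (b * c) := by
    rw [← Finset.sum_fiberwise Finset.univ (fun a : F => a ^ 2)]
    refine Finset.sum_congr rfl fun c _ => ?_
    rw [Finset.sum_congr rfl (g := fun _ => ψ (b * c))
      (fun a ha => by rw [(Finset.mem_filter.1 ha).2])]
    rw [Finset.sum_const, nsmul_eq_mul]
    congr 1
    have := quadraticChar_card_sqrts h2 c
    have h3 : (((Finset.univ.filter (fun a : F => a ^ 2 = c)).card : ℤ)) = quadraticChar F c + 1 := by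
      rw [← this]
      congr 2
      ext a
      simp
    unfold eta
    exact_mod_cast congrArg (Int.cast : ℤ → ℂ) h3
  rw [h]
  simp only [add_mul, one_mul, Finset.sum_add_distrib]
  rw [aux_sum_mul F ψ hψ b hb, add_zero]

lemma aux_gauss (F : Type) [Field F] [Fintype F] [DecidableEq F] (h2 : ringChar F ≠ 2)
    (ψ : AddChar F ℂ) (hψ : ψ ≠ 1) (b : F) (hb : b ≠ 0) :
    ∑ a, ψ (b * a ^ 2) = eta F b * ∑ a, ψ (a ^ 2) := by
  have h1 := aux_sq F h2 ψ hψ 1 one_ne_zero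
  simp only [one_mul] at h1
  rw [aux_sq F h2 ψ hψ b hb, h1, Finset.mul_sum]
  refine Fintype.sum_equiv (Equiv.mulLeft₀ b hb) _ _ (fun c => ?_)
  have h3 : eta F b * eta F b = 1 := by
    unfold eta
    have := quadraticChar_sq_one hb
    rw [sq] at this
    exact_mod_cast this
  have h4 : eta F (b * c) = eta F b * eta F c := by
    unfold eta; rw [map_mul, Int.cast_mul]
  simp only [Equiv.mulLeft₀_apply]
  rw [h4, ← mul_assoc, ← mul_assoc, h3, one_mul]

lemma aux_NS (p : ℕ) (F : Type) [Field F] [Fintype F] [DecidableEq F] [Algebra (ZMod p) F]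
    (τ μ j k : F) : NS p F τ μ j k = ∑ x : F, if x = 0 then 0 else
      if k = 2 * x * τ + j then ∑ a : F, zetaTr p F (x * a ^ 2 * j + τ * (x ^ 2 * a ^ 2) + μ * (x * a))
      else 0 := by
  classical
  have hS : Sfin F = ((Finset.univ.filter (fun x : F => x ≠ 0)) ×ˢ (Finset.univ : Finset F)).image
      (fun z => (z.1, z.1 * z.2, z.1 * z.2 ^ 2, z.1 ^ 2 * z.2, z.1 ^ 2 * z.2 ^ 2)) := by
    ext g
    simp only [Sfin, Finset.mem_filter, Finset.mem_univ, true_and, Finset.mem_image,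
      Finset.mem_product, and_true, Prod.exists]
    constructor
    · rintro ⟨a, x, hx, rfl⟩
      exact ⟨x, a, hx, rfl⟩
    · rintro ⟨x, a, hx, rfl⟩
      exact ⟨a, x, hx, rfl⟩
  unfold NS
  rw [Matrix.sum_apply, hS, Finset.sum_image, Finset.sum_product, Finset.sum_filter]
  · refine Finset.sum_congr rfl fun x _ => ?_
    by_cases hx : x = 0
    · simp [hx]
    · simp only [hx, ne_eq, not_false_eq_true, if_true, if_false, Nrep, Matrix.of_apply]
      split_ifs <;> simp
  · rintro ⟨x, a⟩ hx ⟨y, b⟩ _ h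
    simp only [Finset.coe_product, Set.mem_prod, Finset.mem_coe, Finset.mem_filter] at hx
    simp only [Prod.mk.injEq] at h
    obtain ⟨rfl, h, _⟩ := h
    rw [mul_left_cancel₀ hx.1.2 h]

lemma aux_NS2 (p : ℕ) (F : Type) [Field F] [Fintype F] [DecidableEq F] [Algebra (ZMod p) F]
    (h2 : (2 : F) ≠ 0) (τ μ j k : F) (hτ : τ ≠ 0) (hjk : j ≠ k) :
    NS p F τ μ j k = ∑ a : F, zetaTr p F (Gn τ j k * a ^ 2 + Fn τ μ j k * a) := by
  have hx : (k - j) / (2 * τ) ≠ 0 :=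
    div_ne_zero (sub_ne_zero.2 hjk.symm) (mul_ne_zero h2 hτ)
  rw [aux_NS, Finset.sum_eq_single ((k - j) / (2 * τ))]
  · rw [if_neg hx, if_pos (by field_simp; ring)]
    refine Finset.sum_congr rfl fun a _ => ?_
    congr 1
    have h4 : (4 : F) ≠ 0 := by
      have : (4 : F) = 2 * 2 := by norm_num
      rw [this]; exact mul_ne_zero h2 h2
    unfold Gn Fn
    field_simp
    ring
  · intro x _ hne
    split_ifs with h h'
    · rfl
    · exfalso
      apply hne
      rw [h']
      field_simp
      ring
    · rfl
  · simp

/-- Let `q = p^e` be an odd prime power, `τ, μ ∈ F_q` with `τ ≠ 0`, and write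
`N = N_{τ,μ}(S)`, `F = F_{τ,μ}(j,k)`, `G = G_τ(j,k)`.  Then for all `j, k ∈ F_q`:
`N_{j,k} = η(G)·ζ^{−tr(F²/(4G))}·S_{y²}` if `G ≠ 0`; `N_{j,k} = 0` if `G = 0` and `F ≠ 0`;
`N_{j,k} = 0` if `j = k`; and `N_{j,k} = q` in the remaining case. -/
theorem stmt_18 (p e : ℕ) (hp : p.Prime) (hodd : p ≠ 2) (he : 0 < e)
    (F : Type) [Field F] [Fintype F] [DecidableEq F] [Algebra (ZMod p) F]
    (hcard : Fintype.card F = p ^ e)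
    (τ μ : F) (hτ : τ ≠ 0) (j k : F) :
    (Gn τ j k ≠ 0 →
      NS p F τ μ j k =
        eta F (Gn τ j k) * zetaTr p F (-(Fn τ μ j k ^ 2 / (4 * Gn τ j k))) * Sy2 p F) ∧
    (Gn τ j k = 0 → Fn τ μ j k ≠ 0 → NS p F τ μ j k = 0) ∧
    (j = k → NS p F τ μ j k = 0) ∧
    (Gn τ j k = 0 → Fn τ μ j k = 0 → j ≠ k → NS p F τ μ j k = (p : ℂ) ^ e) := by
  have : Fact p.Prime := ⟨hp⟩
  have : CharP F p := charP_of_injective_algebraMap (algebraMap (ZMod p) F).injective p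
  have hrc : ringChar F ≠ 2 := by rw [ringChar.eq F p]; exact hodd
  have h2 : (2 : F) ≠ 0 := Ring.two_ne_zero hrc
  obtain ⟨ψ, hψ, hz⟩ := aux_char p hp F
  have h4 : (4 : F) ≠ 0 := by
    have : (4 : F) = 2 * 2 := by norm_num
    rw [this]; exact mul_ne_zero h2 h2
  refine ⟨fun hG => ?_, fun hG hF => ?_, ?_, fun hG hF hjk => ?_⟩
  · have hjk : j ≠ k := by rintro rfl; simp [Gn] at hG
    rw [aux_NS2 p F h2 τ μ j k hτ hjk]
    generalize Gn τ j k = G at *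
    generalize Fn τ μ j k = f
    unfold Sy2
    simp only [hz]
    rw [mul_right_comm, ← aux_gauss F hrc ψ hψ G hG, Finset.sum_mul]
    refine Fintype.sum_equiv (Equiv.addRight (f / (2 * G))) _ _ (fun a => ?_)
    rw [← AddChar.map_add_eq_mul]
    congr 1
    simp only [Equiv.coe_addRight]
    field_simp
    ring
  · have hjk : j ≠ k := by rintro rfl; simp [Fn] at hF
    rw [aux_NS2 p F h2 τ μ j k hτ hjk]
    simp only [hG, hz, zero_mul, zero_add]
    exact aux_sum_mul F ψ hψ _ hF
  · rintro rfl
    rw [aux_NS]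
    refine Finset.sum_eq_zero fun x _ => ?_
    split_ifs with h h'
    · rfl
    · exact absurd (right_eq_add.1 h') (mul_ne_zero (mul_ne_zero h2 h) hτ)
    · rfl
  · rw [aux_NS2 p F h2 τ μ j k hτ hjk]
    simp [hG, hF, hz, hcard]
end
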